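/- Fix k, t ∈ ℕ and let π ∈ Π(k,t) be a crossing partition. Then for any sequence of symmetric conference matrices S_n of increasing sizes n, the quantity V_n(π) := (1/n^{k/2+1}) Σ_{a ∈ L_n(π)} Δ(a(1),...,a(k)) satisfies V_n(π) → 0 as n → ∞. -/

import Mathlib

open MeasureTheory ProbabilityTheory Filter Finset
open scoped ENNReal

/-- An `n × n` symmetric conference matrix: symmetric, zero diagonal,
`±1` off the diagonal, and `Sᵀ S = (n-1) I`. -/
def IsConferenceMatrix {n : ℕ} (S : Matrix (Fin n) (Fin n) ℝ) : Prop :=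
  S.IsSymm ∧ (∀ i, S i i = 0) ∧ (∀ i j, i ≠ j → S i j = 1 ∨ S i j = -1) ∧
    S.transpose * S = ((n : ℝ) - 1) • 1

/-- The cyclic successor on `Fin k` (so `k + 1` is identified with `1`). -/
def cyc {k : ℕ} (i : Fin k) : Fin k := ⟨(i.val + 1) % k, Nat.mod_lt _ i.pos⟩

/-- `Δ(a₁, …, a_k) = S_{a₁a₂} S_{a₂a₃} ⋯ S_{a_k a₁}`. -/
def Delta {k n : ℕ} (S : Matrix (Fin n) (Fin n) ℝ) (a : Fin k → Fin n) : ℝ :=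
  ∏ i : Fin k, S (a i) (a (cyc i))

/-- The set of level sets of `a : [k] → [n]`, i.e. `{a⁻¹(a(i)) : i ∈ [k]}`. -/
def levelSets {k n : ℕ} (a : Fin k → Fin n) : Finset (Finset (Fin k)) :=
  Finset.image (fun i => Finset.univ.filter fun j => a j = a i) Finset.univ

/-- `L_n(π)`: the functions `a : [k] → [n]` whose level sets are exactly the blocks of `π`. -/
def Ln {k : ℕ} (n : ℕ) (π : Finset (Finset (Fin k))) : Finset (Fin k → Fin n) :=
  Finset.univ.filter fun a => levelSets a = π

/-- `V_n(π) = n^{-(k/2+1)} Σ_{a ∈ L_n(π)} Δ(a(1), …, a(k))`. -/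
noncomputable def Vn {k : ℕ} (n : ℕ) (S : Matrix (Fin n) (Fin n) ℝ)
    (π : Finset (Finset (Fin k))) : ℝ :=
  (∑ a ∈ Ln n π, Delta S a) / (n : ℝ) ^ ((k : ℝ) / 2 + 1)

/-- `π` is a partition of `[k]` into nonempty blocks. -/
def IsPartitionOf (k : ℕ) (π : Finset (Finset (Fin k))) : Prop :=
  ∅ ∉ π ∧ ∀ i : Fin k, ∃! B, B ∈ π ∧ i ∈ B

/-- The block `π(i)` of `π` containing `i` (a junk value if `π` is not a partition). -/
def part {k : ℕ} (π : Finset (Finset (Fin k))) (i : Fin k) : Finset (Fin k) :=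
  Finset.univ.filter fun j => ∀ B ∈ π, (i ∈ B ↔ j ∈ B)

/-- `π` is a crossing partition. -/
def IsCrossing {k : ℕ} (π : Finset (Finset (Fin k))) : Prop :=
  ∃ A ∈ π, ∃ B ∈ π, A ≠ B ∧
    ∃ a₁ ∈ A, ∃ a₂ ∈ A, ∃ b₁ ∈ B, ∃ b₂ ∈ B, a₁ < b₁ ∧ b₁ < a₂ ∧ a₂ < b₂

/-- `π` is loop-free: `π(x) ≠ π(x+1)` for all `x ∈ [k]` (mod `k`). -/
def LoopFree {k : ℕ} (π : Finset (Finset (Fin k))) : Prop :=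
  ∀ x : Fin k, part π x ≠ part π (cyc x)

/-- The edge of the multigraph `G_π` indexed by `x ∈ [k]` (joining `π(x)` and `π(x+1)`)
has endpoints `A` and `B`. -/
def EdgeConnects {k : ℕ} (π : Finset (Finset (Fin k))) (x : Fin k)
    (A B : Finset (Fin k)) : Prop :=
  (part π x = A ∧ part π (cyc x) = B) ∨ (part π x = B ∧ part π (cyc x) = A)

/-- The edges of `G_π` indexed by `T ⊆ [k]` form a simple cycle of length `ℓ`:
there are `ℓ` distinct vertices `v 0, …, v (ℓ-1)` and a bijection between `T` and the
cyclically consecutive pairs of vertices. -/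
def IsSimpleCycleOn {k : ℕ} (π : Finset (Finset (Fin k))) (T : Finset (Fin k))
    (ℓ : ℕ) : Prop :=
  2 ≤ ℓ ∧ ∃ (e : ZMod ℓ ≃ {x // x ∈ T}) (v : ZMod ℓ → Finset (Fin k)),
    Function.Injective v ∧
      ∀ i : ZMod ℓ, EdgeConnects π ((e i : {x // x ∈ T}) : Fin k) (v i) (v (i + 1))

/-- The `k` edges of `G_π` partition into `m` simple cycles of lengths `ℓ 1, …, ℓ m`. -/
def EdgesPartitionIntoCycles {k : ℕ} (π : Finset (Finset (Fin k))) (m : ℕ)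
    (ℓ : Fin m → ℕ) : Prop :=
  ∃ T : Fin m → Finset (Fin k),
    (∀ i j, i ≠ j → Disjoint (T i) (T j)) ∧
    Finset.univ.biUnion T = Finset.univ ∧
    ∀ i, IsSimpleCycleOn π (T i) (ℓ i)

/-- Membership in `EC(k,t)`: a non-crossing partition of `[k]` into `t` blocks whose
multigraph `G_π` has its edges partitioned into simple even cycles. -/
def InEC (k t : ℕ) (π : Finset (Finset (Fin k))) : Prop :=
  IsPartitionOf k π ∧ π.card = t ∧ ¬ IsCrossing π ∧
    ∃ (m : ℕ) (s : Fin m → ℕ), EdgesPartitionIntoCycles π m fun i => 2 * s i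

/-- The weight `M a c₁ * M c₁ c₂ * ⋯ * M cₘ b` of the walk from `a` to `b` through the word `c`. -/
def walkWeight {V : Type*} (M : V → V → ℝ) : V → List V → V → ℝ
  | a, [], b => M a b
  | a, c :: r, b => M a c * walkWeight M c r b

/-- The weight of the closed walk that visits the letters of a word cyclically. -/
def cycleWeight {V : Type*} (M : V → V → ℝ) : List V → ℝ
  | [] => 1
  | a :: r => walkWeight M a r a

/-- A word is crossing if it contains two distinct letters in the pattern `abab`. -/
def CrossingWord {V : Type*} (w : List V) : Prop :=
  ∃ a b, a ≠ b ∧ List.Sublist [a, b, a, b] w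

section Weights

variable {V : Type*} (M : V → V → ℝ)

lemma walkWeight_concat (a : V) (r : List V) (c b : V) :
    walkWeight M a (r ++ [c]) b = walkWeight M a r c * M c b := by
  induction r generalizing a with
  | nil => simp [walkWeight]
  | cons d r ih => simp [walkWeight, ih, mul_assoc]

lemma cycleWeight_concat (a : V) (r : List V) :
    cycleWeight M (r ++ [a]) = cycleWeight M (a :: r) := by
  cases r with
  | nil => rfl
  | cons b r => simp [cycleWeight, walkWeight_concat, walkWeight, mul_comm]

lemma cycleWeight_append_comm (p q : List V) :
    cycleWeight M (p ++ q) = cycleWeight M (q ++ p) := by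
  induction p generalizing q with
  | nil => simp
  | cons a p ih =>
    rw [List.cons_append, ← cycleWeight_concat, List.append_assoc, ih (q ++ [a])]
    simp

lemma walkWeight_range_map (h : ℕ → V) (m : ℕ) :
    walkWeight M (h 0) ((List.range m).map fun i => h (i + 1)) (h (m + 1)) =
      ∏ i ∈ Finset.range (m + 1), M (h i) (h (i + 1)) := by
  induction m with
  | zero => simp [walkWeight]
  | succ m ih =>
    rw [List.range_succ, List.map_append, List.map_singleton, walkWeight_concat, ih,
      Finset.prod_range_succ _ (m + 1)]

lemma cycleWeight_range_map (h : ℕ → V) (k : ℕ) (hk : h k = h 0) :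
    cycleWeight M ((List.range k).map h) = ∏ i ∈ Finset.range k, M (h i) (h (i + 1)) := by
  cases k with
  | zero => simp [cycleWeight]
  | succ m =>
    rw [← walkWeight_range_map, hk, List.range_succ_eq_map, List.map_cons, List.map_map]
    rfl

lemma abs_walkWeight_le_one (hM : ∀ i j, |M i j| ≤ 1) (a : V) (r : List V) (b : V) :
    |walkWeight M a r b| ≤ 1 := by
  induction r generalizing a with
  | nil => exact hM a b
  | cons c r ih =>
    rw [walkWeight, abs_mul]
    exact mul_le_one₀ (hM a c) (abs_nonneg _) (ih c)

lemma abs_cycleWeight_le_one (hM : ∀ i j, |M i j| ≤ 1) (w : List V) :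
    |cycleWeight M w| ≤ 1 := by
  cases w with
  | nil => simp [cycleWeight]
  | cons a r => exact abs_walkWeight_le_one M hM a r a

end Weights

section Crossing

variable {V : Type*}

lemma CrossingWord.mono {p q : List V} (hp : CrossingWord p) (h : p.Sublist q) :
    CrossingWord q := by
  obtain ⟨a, b, hab, hs⟩ := hp
  exact ⟨a, b, hab, hs.trans h⟩

lemma CrossingWord.concat_of_cons {x : V} {p : List V} (h : CrossingWord (x :: p)) :
    CrossingWord (p ++ [x]) := by
  obtain ⟨a, b, hab, hs⟩ := h
  rcases List.sublist_cons_iff.1 hs with hs | ⟨r, hr, hs⟩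
  · exact ⟨a, b, hab, hs.trans (List.sublist_append_left _ _)⟩
  · obtain ⟨rfl, rfl⟩ := List.cons.inj hr
    exact ⟨b, a, hab.symm, hs.append (List.Sublist.refl [a])⟩

lemma CrossingWord.append_comm {p q : List V} (h : CrossingWord (p ++ q)) :
    CrossingWord (q ++ p) := by
  induction p generalizing q with
  | nil => simpa using h
  | cons a p ih =>
    have := ih (q := q ++ [a]) (by simpa using h.concat_of_cons)
    simpa using this

lemma CrossingWord.of_cons_of_notMem {x : V} {p : List V} (h : CrossingWord (x :: p))
    (hx : x ∉ p) : CrossingWord p := by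
  obtain ⟨a, b, hab, hs⟩ := h
  rcases List.sublist_cons_iff.1 hs with hs | ⟨r, hr, hs⟩
  · exact ⟨a, b, hab, hs⟩
  · obtain ⟨rfl, rfl⟩ := List.cons.inj hr
    exact absurd (hs.subset (by simp)) hx

lemma CrossingWord.of_map {W : Type*} {f : V → W} (hf : Function.Injective f) {p : List V}
    (h : CrossingWord (p.map f)) : CrossingWord p := by
  obtain ⟨a, b, hab, hs⟩ := h
  obtain ⟨l, hl, he⟩ := List.sublist_map_iff.1 hs
  obtain ⟨c, l, rfl, rfl, he⟩ := List.map_eq_cons_iff.1 he.symm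
  obtain ⟨d, l, rfl, rfl, he⟩ := List.map_eq_cons_iff.1 he
  obtain ⟨c', l, rfl, hc, he⟩ := List.map_eq_cons_iff.1 he
  obtain ⟨d', l, rfl, hd, he⟩ := List.map_eq_cons_iff.1 he
  obtain rfl := List.map_eq_nil_iff.1 he
  obtain rfl := hf hc
  obtain rfl := hf hd
  exact ⟨c', d', fun h => hab (congrArg f h), hl⟩

/-- Identifying the two ends of a word with equal first and last letters preserves crossings. -/
lemma CrossingWord.of_cons_concat {u : V} {r : List V} (h : CrossingWord (u :: (r ++ [u]))) :
    CrossingWord (u :: r) := by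
  obtain ⟨a, b, hab, hs⟩ := CrossingWord.append_comm (p := u :: r) (q := [u]) h
  rcases List.sublist_cons_iff.1 hs with hs | ⟨l, hl, hs⟩
  · exact ⟨a, b, hab, hs⟩
  · obtain ⟨rfl, rfl⟩ := List.cons.inj hl
    rcases List.sublist_cons_iff.1 hs with hs | ⟨l, hl, hs⟩
    · exact ⟨a, b, hab, hs.cons_cons a⟩
    · exact absurd (List.cons.inj hl).1.symm hab

lemma CrossingWord.exists_eq_cons_concat {p : List V} (h : CrossingWord p) :
    ∃ u r v, p = u :: (r ++ [v]) := by
  obtain ⟨a, b, hab, hs⟩ := h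
  have hlen := hs.length_le
  match p, hlen with
  | u :: q, hlen =>
    rcases List.eq_nil_or_concat q with rfl | ⟨r, v, rfl⟩
    · simp at hlen
    · exact ⟨u, r, v, by simp⟩

end Crossing

/-- If a word is shorter than twice the size of its alphabet and uses every letter, then
some letter occurs exactly once. -/
lemma exists_split_of_length_lt {V : Type*} [Fintype V] (w : List V) (hw : ∀ v, v ∈ w)
    (hlen : w.length < 2 * Fintype.card V) :
    ∃ x p q, w = p ++ x :: q ∧ x ∉ p ∧ x ∉ q := by
  classical
  have hcount : ∃ x, w.count x < 2 := by
    by_contra! hc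
    have h1 : ∑ v : V, w.count v = w.length := by
      have := Multiset.sum_count_eq_card (s := Finset.univ) (m := (w : Multiset V)) (by simp)
      simpa using this
    have h2 : ∑ v : V, 2 ≤ ∑ v : V, w.count v := Finset.sum_le_sum fun v _ => hc v
    simp at h2
    omega
  obtain ⟨x, hx⟩ := hcount
  obtain ⟨p, q, rfl⟩ := List.append_of_mem (hw x)
  refine ⟨x, p, q, rfl, ?_, ?_⟩ <;> rw [← List.count_pos_iff] <;> simp at hx <;> omega

/-- Summing over injections of `Fin (t + 1)` amounts to summing over injections of the remaining
`t` labels and over the values that avoid their range. -/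
lemma sum_embedding_succAbove {t n : ℕ} (x : Fin (t + 1))
    (F : (Fin t ↪ Fin n) → Fin n → ℝ) :
    ∑ φ : Fin (t + 1) ↪ Fin n, F (x.succAboveEmb.trans φ) (φ x) =
      ∑ ψ : Fin t ↪ Fin n, (∑ z, F ψ z - ∑ v, F ψ (ψ v)) := by
  classical
  let e := (Equiv.embeddingCongr (finSuccEquiv' x) (Equiv.refl (Fin n))).trans
    (Function.Embedding.optionEmbeddingEquiv (Fin t) (Fin n))
  have h : ∀ φ, F (x.succAboveEmb.trans φ) (φ x) = F (e φ).1 (e φ).2 := fun _ => rfl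
  simp_rw [h]
  rw [Equiv.sum_comp e (fun y => F y.1 y.2), Fintype.sum_sigma]
  refine Finset.sum_congr rfl fun ψ _ => ?_
  rw [← Finset.sum_map Finset.univ ψ (F ψ), eq_sub_iff_add_eq]
  have h2 := Finset.sum_add_sum_compl (Finset.univ.map ψ) (F ψ)
  rw [← h2, add_comm]
  congr 1
  symm
  refine Finset.sum_subtype _ (fun z => ?_) (F ψ)
  simp

namespace IsConferenceMatrix

variable {n : ℕ} {S : Matrix (Fin n) (Fin n) ℝ}

lemma abs_le_one (hS : IsConferenceMatrix S) (i j : Fin n) : |S i j| ≤ 1 := by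
  obtain ⟨-, h0, h1, -⟩ := hS
  rcases eq_or_ne i j with rfl | hij
  · simp [h0]
  · rcases h1 i j hij with h | h <;> simp [h]

lemma sum_mul (hS : IsConferenceMatrix S) (u v : Fin n) :
    ∑ z, S z u * S v z = if u = v then (n : ℝ) - 1 else 0 := by
  obtain ⟨hs, -, -, h⟩ := hS
  have h2 := congrFun (congrFun h u) v
  simp only [Matrix.mul_apply, Matrix.transpose_apply, Matrix.smul_apply, Matrix.one_apply] at h2
  simp_rw [hs.apply _ v] at *
  simpa using h2

end IsConferenceMatrix

/-- The sum of the cycle weights of a word over all injective labellings of its letters. -/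
noncomputable def injSum {t n : ℕ} (S : Matrix (Fin n) (Fin n) ℝ) (w : List (Fin t)) : ℝ :=
  ∑ φ : Fin t ↪ Fin n, cycleWeight S (w.map φ)

lemma injSum_append_comm {t n : ℕ} (S : Matrix (Fin n) (Fin n) ℝ) (p q : List (Fin t)) :
    injSum S (p ++ q) = injSum S (q ++ p) := by
  simp only [injSum, List.map_append, cycleWeight_append_comm S (p.map _)]

/-- Summing out a letter that occurs once. -/
lemma injSum_cons_map_succAbove {t n : ℕ} {S : Matrix (Fin n) (Fin n) ℝ}
    (hS : IsConferenceMatrix S) (x : Fin (t + 1)) (u v : Fin t) (r : List (Fin t)) :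
    injSum S (x :: (u :: (r ++ [v])).map x.succAbove) =
      (if u = v then ((n : ℝ) - 1) * injSum S (u :: r) else 0) -
        ∑ c, injSum S (c :: u :: (r ++ [v])) := by
  have h := sum_embedding_succAbove (n := n) x
    fun ψ z => cycleWeight S (z :: (u :: (r ++ [v])).map ψ)
  have h1 : injSum S (x :: (u :: (r ++ [v])).map x.succAbove) =
      ∑ φ : Fin (t + 1) ↪ Fin n,
        cycleWeight S (φ x :: (u :: (r ++ [v])).map (x.succAboveEmb.trans φ)) := by
    refine Finset.sum_congr rfl fun φ _ => ?_
    rw [List.map_cons, List.map_map]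
    rfl
  rw [h1, h, Finset.sum_sub_distrib]
  refine congrArg₂ (· - ·) ?_ Finset.sum_comm
  have h2 : ∀ ψ : Fin t ↪ Fin n, ∑ z, cycleWeight S (z :: (u :: (r ++ [v])).map ψ) =
      walkWeight S (ψ u) (r.map ψ) (ψ v) * if u = v then (n : ℝ) - 1 else 0 := by
    intro ψ
    have := hS.sum_mul (ψ u) (ψ v)
    simp only [ψ.injective.eq_iff] at this
    rw [← this, Finset.mul_sum]
    refine Finset.sum_congr rfl fun z _ => ?_
    simp only [cycleWeight, List.map_cons, List.map_append, List.map_nil, walkWeight,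
      walkWeight_concat S]
    ring
  simp_rw [h2]
  split_ifs with huv
  · subst huv
    rw [← Finset.sum_mul, mul_comm]
    rfl
  · simp

lemma injSum_le_of_two_mul_le {t n : ℕ} {S : Matrix (Fin n) (Fin n) ℝ}
    (hS : IsConferenceMatrix S) (hn : 1 ≤ n) (w : List (Fin t)) (h : 2 * t ≤ w.length + 1) :
    |injSum S w| ≤ √n ^ (w.length + 1) := by
  have hn' : (1 : ℝ) ≤ √n := by rw [Real.one_le_sqrt]; exact_mod_cast hn
  calc |injSum S w| ≤ ∑ φ : Fin t ↪ Fin n, |cycleWeight S (w.map φ)| :=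
        Finset.abs_sum_le_sum_abs _ _
    _ ≤ ∑ φ : Fin t ↪ Fin n, (1 : ℝ) :=
        Finset.sum_le_sum fun φ _ => abs_cycleWeight_le_one S hS.abs_le_one _
    _ = (Fintype.card (Fin t ↪ Fin n) : ℝ) := by simp
    _ ≤ (n : ℝ) ^ t := by
        rw [Fintype.card_embedding_eq]
        simp only [Fintype.card_fin]
        exact_mod_cast Nat.descFactorial_le_pow n t
    _ = √n ^ (2 * t) := by rw [pow_mul, Real.sq_sqrt (Nat.cast_nonneg n)]
    _ ≤ √n ^ (w.length + 1) := pow_le_pow_right₀ hn' h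

/-- Crossing words have injective sums that are smaller by a factor `√n` than the natural
normalization. -/
theorem exists_abs_injSum_le (t : ℕ) (w : List (Fin t)) (hw : ∀ v, v ∈ w)
    (hc : CrossingWord w) :
    ∃ C : ℝ, ∀ (n : ℕ) (S : Matrix (Fin n) (Fin n) ℝ), IsConferenceMatrix S → 1 ≤ n →
      |injSum S w| ≤ C * √n ^ (w.length + 1) := by
  induction t with
  | zero => exact hc.choose.elim0
  | succ t ih =>
    rcases le_or_gt (2 * (t + 1)) (w.length + 1) with hlen | hlen
    · exact ⟨1, fun n S hS hn => by simpa using injSum_le_of_two_mul_le hS hn w hlen⟩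
    obtain ⟨x, l, q, rfl, hxl, hxq⟩ :=
      exists_split_of_length_lt w hw (by rw [Fintype.card_fin]; omega)
    obtain ⟨p, hp⟩ : ∃ p : List (Fin t), p.map x.succAbove = q ++ l := by
      have : q ++ l ∈ Set.range (List.map x.succAbove) := by
        rw [Set.range_list_map]
        rintro y hy
        rw [Fin.range_succAbove]
        rintro rfl
        simp_all
      exact this
    have hxp : x ∉ p.map x.succAbove := by simp [hp, hxl, hxq]
    have hcp : CrossingWord p := by
      have := hc.append_comm
      rw [List.cons_append, ← hp] at this
      exact (this.of_cons_of_notMem hxp).of_map x.succAbove_right_injective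
    have hmem : ∀ v, v ∈ p := by
      intro v
      have : x.succAbove v ∈ p.map x.succAbove := by
        have h1 := hw (x.succAbove v)
        have h2 : x.succAbove v ≠ x := Fin.succAbove_ne x v
        rw [hp]
        simp [h2] at h1 ⊢
        tauto
      simpa using this
    have hlenp : (l ++ x :: q).length = p.length + 1 := by
      have := congrArg List.length hp
      simp at this ⊢
      omega
    obtain ⟨u, r, v, rfl⟩ := hcp.exists_eq_cons_concat
    have hmerge : ∀ c, ∃ C : ℝ, ∀ (n : ℕ) (S : Matrix (Fin n) (Fin n) ℝ),
        IsConferenceMatrix S → 1 ≤ n → |injSum S (c :: u :: (r ++ [v]))| ≤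
          C * √n ^ ((c :: u :: (r ++ [v])).length + 1) := fun c =>
      ih _ (fun y => List.mem_cons_of_mem _ (hmem y)) (hcp.mono (List.sublist_cons_self _ _))
    choose C hC using hmerge
    obtain ⟨D, hD⟩ : ∃ D : ℝ, ∀ (n : ℕ) (S : Matrix (Fin n) (Fin n) ℝ),
        IsConferenceMatrix S → 1 ≤ n →
        |if u = v then ((n : ℝ) - 1) * injSum S (u :: r) else 0| ≤
          D * √n ^ ((u :: r).length + 1 + 2) := by
      split_ifs with huv
      · subst huv
        obtain ⟨D, hD⟩ := ih (u :: r) (fun y => by have := hmem y; simp at this ⊢; tauto) hcp.of_cons_concat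
        refine ⟨D, fun n S hS hn => ?_⟩
        have hn' : (1 : ℝ) ≤ n := by exact_mod_cast hn
        rw [abs_mul, abs_of_nonneg (sub_nonneg.2 hn'), pow_add _ _ 2,
          Real.sq_sqrt (Nat.cast_nonneg n), ← mul_assoc, mul_comm]
        exact mul_le_mul (hD n S hS hn) (by linarith) (by linarith)
          ((abs_nonneg _).trans (hD n S hS hn))
      · exact ⟨0, by simp⟩
    refine ⟨D + ∑ c, C c, fun n S hS hn => ?_⟩
    rw [injSum_append_comm, List.cons_append, ← hp, injSum_cons_map_succAbove hS, add_mul,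
      Finset.sum_mul, hlenp]
    refine (abs_sub _ _).trans (add_le_add ?_ ?_)
    · simpa [add_assoc] using hD n S hS hn
    · refine (Finset.abs_sum_le_sum_abs _ _).trans (Finset.sum_le_sum fun c _ => ?_)
      simpa using hC c n S hS hn

/-- A partition is the kernel of a surjective labelling of `[k]` by its blocks. -/
lemma IsPartitionOf.exists_labelling {k : ℕ} {π : Finset (Finset (Fin k))}
    (hπ : IsPartitionOf k π) :
    ∃ f : Fin k → Fin π.card, Function.Surjective f ∧
      (∀ B ∈ π, ∀ i ∈ B, ∀ j, f i = f j ↔ j ∈ B) ∧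
      ∀ (n : ℕ) (a : Fin k → Fin n), a ∈ Ln n π ↔ ∀ i j, a i = a j ↔ f i = f j := by
  obtain ⟨hne, hu⟩ := hπ
  choose B hB hBu using hu
  simp only at hB hBu
  have key : ∀ A ∈ π, ∀ i ∈ A, B i = A := fun A hA i hi => (hBu i A ⟨hA, hi⟩).symm
  let f : Fin k → Fin π.card := fun i => π.equivFin ⟨B i, (hB i).1⟩
  have hf : ∀ i j, f i = f j ↔ B i = B j := by simp [f]
  refine ⟨f, fun y => ?_, fun A hA i hi j => ?_, fun n a => ?_⟩
  · obtain ⟨i, hi⟩ := Finset.nonempty_iff_ne_empty.2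
      fun h => hne (h ▸ (π.equivFin.symm y).2)
    refine ⟨i, ?_⟩
    simp [f, key _ (π.equivFin.symm y).2 i hi]
  · rw [hf, key A hA i hi]
    exact ⟨fun h => h ▸ (hB j).2, fun h => (key A hA j h).symm⟩
  · simp only [Ln, Finset.mem_filter, Finset.mem_univ, true_and, hf]
    constructor
    · intro h i j
      have hl : ∀ i, (Finset.univ.filter fun j => a j = a i) = B i := by
        intro i
        refine (key _ ?_ i (by simp)).symm
        rw [← h]
        exact Finset.mem_image_of_mem _ (Finset.mem_univ i)
      constructor
      · intro hij
        rw [← hl i, ← hl j, hij]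
      · intro hij
        have : i ∈ B j := hij ▸ (hB i).2
        rw [← hl j] at this
        simpa using this
    · intro h
      have hl : ∀ i, (Finset.univ.filter fun j => a j = a i) = B i := by
        intro i
        ext j
        simp only [Finset.mem_filter, Finset.mem_univ, true_and, h]
        exact ⟨fun hj => hj ▸ (hB j).2, fun hj => key _ (hB i).1 j hj⟩
      ext A
      simp only [levelSets, hl, Finset.mem_image, Finset.mem_univ, true_and]
      constructor
      · rintro ⟨i, rfl⟩
        exact (hB i).1
      · intro hA
        obtain ⟨i, hi⟩ := Finset.nonempty_iff_ne_empty.2 fun h => hne (h ▸ hA)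
        exact ⟨i, key A hA i hi⟩

lemma Delta_eq_cycleWeight {k n : ℕ} [NeZero k] (S : Matrix (Fin n) (Fin n) ℝ)
    (a : Fin k → Fin n) :
    Delta S a = cycleWeight S ((List.range k).map fun i => a (Fin.ofNat k i)) := by
  rw [cycleWeight_range_map S (fun i => a (Fin.ofNat k i)) k (by simp [Fin.ofNat]),
    Finset.prod_range, Delta]
  refine Finset.prod_congr rfl fun i _ => ?_
  congr 2
  ext
  simp

lemma sum_Delta_eq_injSum {k t n : ℕ} [NeZero k] {π : Finset (Finset (Fin k))}
    {f : Fin k → Fin t} (hf : Function.Surjective f)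
    (hL : ∀ a : Fin k → Fin n, a ∈ Ln n π ↔ ∀ i j, a i = a j ↔ f i = f j)
    (S : Matrix (Fin n) (Fin n) ℝ) :
    ∑ a ∈ Ln n π, Delta S a = injSum S ((List.range k).map fun i => f (Fin.ofNat k i)) := by
  symm
  refine Finset.sum_bij (fun φ _ => φ ∘ f) ?_ ?_ ?_ ?_
  · intro φ _
    simp [hL]
  · intro φ _ ψ _ h
    exact DFunLike.coe_injective (hf.injective_comp_right h)
  · intro a ha
    rw [hL] at ha
    have hs := Function.rightInverse_surjInv hf
    refine ⟨⟨fun y => a (Function.surjInv hf y), fun y z h => ?_⟩, Finset.mem_univ _, ?_⟩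
    · simpa [ha, hs _] using h
    · funext i
      exact (ha _ _).2 (hs (f i))
  · intro φ _
    simp [Delta_eq_cycleWeight, Function.comp_def]

lemma IsCrossing.crossingWord {k t : ℕ} [NeZero k] {π : Finset (Finset (Fin k))}
    (hπ : IsPartitionOf k π) (hc : IsCrossing π) {f : Fin k → Fin t}
    (hf : ∀ B ∈ π, ∀ i ∈ B, ∀ j, f i = f j ↔ j ∈ B) :
    CrossingWord ((List.range k).map fun i => f (Fin.ofNat k i)) := by
  obtain ⟨A, hA, B, hB, hAB, a₁, ha₁, a₂, ha₂, b₁, hb₁, b₂, hb₂, h1, h2, h3⟩ := hc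
  refine ⟨f a₁, f b₁, fun h => ?_, ?_⟩
  · exact hAB ((hπ.2 b₁).unique ⟨hA, (hf A hA a₁ ha₁ b₁).1 h⟩ ⟨hB, hb₁⟩)
  · have hs : List.Sublist [a₁.val, b₁.val, a₂.val, b₂.val] (List.range k) := by
      refine List.sublist_of_subperm_of_sortedLE (List.subperm_of_subset ?_ ?_) ?_ ?_
      · simp; omega
      · intro y; simp; omega
      · simp [List.sortedLE_iff_pairwise]; omega
      · exact List.pairwise_le_range.sortedLE
    have := hs.map fun i => f (Fin.ofNat k i)
    simpa [← (hf A hA a₁ ha₁ a₂).2 ha₂, ← (hf B hB b₁ hb₁ b₂).2 hb₂] using this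

/-- If `π ∈ Π(k,t)` is a crossing partition, then `V_n(π) → 0` along any
sequence of symmetric conference matrices of increasing sizes. -/
theorem stmt16 (k t : ℕ) (π : Finset (Finset (Fin k)))
    (hπ : IsPartitionOf k π) (hcard : π.card = t) (hcross : IsCrossing π)
    (n : ℕ → ℕ) (hmono : StrictMono n)
    (S : ∀ i, Matrix (Fin (n i)) (Fin (n i)) ℝ)
    (hS : ∀ i, IsConferenceMatrix (S i)) :
    Tendsto (fun i => Vn (n i) (S i) π) atTop (nhds 0) := by
  have : NeZero k := by
    obtain ⟨-, -, -, -, -, a₁, -⟩ := hcross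
    exact ⟨a₁.pos.ne'⟩
  obtain ⟨f, hf, hfB, hL⟩ := hπ.exists_labelling
  obtain ⟨C, hC⟩ := exists_abs_injSum_le _ ((List.range k).map fun i => f (Fin.ofNat k i))
    (fun v => by
      obtain ⟨i, rfl⟩ := hf v
      exact List.mem_map.2 ⟨i, by simp, by simp⟩)
    (hcross.crossingWord hπ hfB)
  have hsqrt : Tendsto (fun i => √(n i : ℝ)) atTop atTop :=
    Real.tendsto_sqrt_atTop.comp (tendsto_natCast_atTop_atTop.comp hmono.tendsto_atTop)
  refine squeeze_zero_norm' ?_ (hsqrt.const_div_atTop C)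
  filter_upwards [hmono.tendsto_atTop.eventually_ge_atTop 1] with i hi
  have hpos : (0 : ℝ) < n i := by exact_mod_cast hi
  have hs : 0 < √(n i : ℝ) := Real.sqrt_pos.2 hpos
  have hpow : (n i : ℝ) ^ ((k : ℝ) / 2 + 1) = √(n i : ℝ) ^ (k + 1) * √(n i : ℝ) := by
    rw [← pow_succ, Real.sqrt_eq_rpow, ← Real.rpow_natCast, ← Real.rpow_mul hpos.le]
    push_cast
    ring_nf
  have hb := hC (n i) (S i) (hS i) hi
  rw [List.length_map, List.length_range] at hb
  rw [Vn, sum_Delta_eq_injSum hf (hL (n i)), Real.norm_eq_abs, abs_div, hpow,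
    abs_of_pos (mul_pos (pow_pos hs _) hs), div_le_div_iff₀ (by positivity) hs]
  calc _ ≤ C * √(n i : ℝ) ^ (k + 1) * √(n i : ℝ) := by gcongr
    _ = _ := by ring
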